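/- In the variety of 3-dimensional complex Lie algebra laws, 𝔰𝔩₂(ℂ) degenerates to 𝔯_{3,−1}(ℂ): the law of 𝔯_{3,−1}(ℂ) lies in the closure of the GL_3(ℂ)-orbit of the law of 𝔰𝔩₂(ℂ). -/

import Mathlib

open Module Submodule Filter Topology

/-- The underlying vector space `ℂⁿ`. -/
abbrev V (n : ℕ) : Type := Fin n → ℂ

/-- A Lie algebra law on `ℂⁿ`: an alternating bilinear map satisfying the Jacobi identity. -/
def IsLieLaw {n : ℕ} (μ : V n → V n → V n) : Prop :=
  (∀ (a : ℂ) (x y z : V n), μ (a • x + y) z = a • μ x z + μ y z) ∧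
  (∀ (a : ℂ) (x y z : V n), μ x (a • y + z) = a • μ x y + μ x z) ∧
  (∀ x : V n, μ x x = 0) ∧
  (∀ x y z : V n, μ x (μ y z) + μ y (μ z x) + μ z (μ x y) = 0)

/-- The base-change action of `GL_n(ℂ)` on laws: `(g·μ)(x,y) = g (μ (g⁻¹ x) (g⁻¹ y))`. -/
noncomputable def act {n : ℕ} (g : V n ≃ₗ[ℂ] V n) (μ : V n → V n → V n) : V n → V n → V n :=
  fun x y => g (μ (g.symm x) (g.symm y))

/-- The `GL_n(ℂ)`-orbit of a law. -/
def lieOrbit {n : ℕ} (μ : V n → V n → V n) : Set (V n → V n → V n) :=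
  {ν | ∃ g : V n ≃ₗ[ℂ] V n, ν = act g μ}

/-- `μ` is a degeneration of `λ` if `μ` lies in the closure of the orbit of `λ`. -/
def Degenerates {n : ℕ} (lam mu : V n → V n → V n) : Prop :=
  mu ∈ closure (lieOrbit lam)

/-- The law of `𝔰𝔩₂(ℂ)` on `ℂ³`:
`[e₁,e₂] = e₃`, `[e₁,e₃] = −2e₁`, `[e₂,e₃] = 2e₂`. -/
noncomputable def sl2Law : V 3 → V 3 → V 3 := fun x y =>
  ![-2 * (x 0 * y 2 - x 2 * y 0),
    2 * (x 1 * y 2 - x 2 * y 1),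
    x 0 * y 1 - x 1 * y 0]

/-- The law `𝔯_{3,−1}(ℂ)` on `ℂ³`: `[e₁,e₂] = e₂`, `[e₁,e₃] = −e₃`. -/
noncomputable def r3m1Law : V 3 → V 3 → V 3 := fun x y =>
  ![0,
    x 0 * y 1 - x 1 * y 0,
    -(x 0 * y 2 - x 2 * y 0)]

/-- The base change sending `e₃/2, t e₁, t e₂` to `e₁, e₂, e₃`. -/
noncomputable def degBase (t : ℂ) (ht : t ≠ 0) : V 3 ≃ₗ[ℂ] V 3 where
  toFun y := ![2 * y 2, t⁻¹ * y 0, t⁻¹ * y 1]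
  invFun x := ![t * x 1, t * x 2, x 0 / 2]
  map_add' x y := by
    ext i; fin_cases i <;> simp <;> ring
  map_smul' a x := by
    ext i; fin_cases i <;> simp <;> ring
  left_inv x := by
    ext i; fin_cases i <;> simp [ht]
  right_inv x := by
    ext i; fin_cases i <;> simp [ht]; ring

/-- The law in the orbit of `𝔰𝔩₂` with parameter `t`. -/
noncomputable def famLaw (t : ℂ) : V 3 → V 3 → V 3 := fun x y =>
  ![2 * t ^ 2 * (x 1 * y 2 - x 2 * y 1),
    x 0 * y 1 - x 1 * y 0,
    -(x 0 * y 2 - x 2 * y 0)]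

theorem famLaw_mem (t : ℂ) (ht : t ≠ 0) : famLaw t ∈ lieOrbit sl2Law := by
  refine ⟨degBase t ht, ?_⟩
  funext x y i
  fin_cases i <;> simp [famLaw, act, degBase, sl2Law] <;> field_simp <;> ring

theorem stmt19 : Degenerates sl2Law r3m1Law := by
  have hc : Continuous famLaw := by
    refine continuous_pi fun x => continuous_pi fun y => continuous_pi fun i => ?_
    fin_cases i <;> simp [famLaw] <;> fun_prop
  have h0 : famLaw 0 = r3m1Law := by
    funext x y i
    fin_cases i <;> simp [famLaw, r3m1Law]
  have ht : Tendsto famLaw (𝓝[≠] 0) (𝓝 r3m1Law) := by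
    rw [← h0]
    exact hc.continuousAt.tendsto.mono_left nhdsWithin_le_nhds
  refine mem_closure_of_tendsto ht ?_
  filter_upwards [self_mem_nhdsWithin] with t h
  exact famLaw_mem t h
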